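/- (Ulm's Theorem) Let p be a prime and let G and H be countable reduced abelian p-groups. Then G ≅ H if and only if u(α,G) = u(α,H) for all ordinals α. -/

import Mathlib

noncomputable section

namespace UlmW

universe u

variable {R : Type*} [CommRing R]

/-- The submodule `p^α M`, defined by transfinite recursion on `α`. -/
def ppow {M : Type u} [AddCommGroup M] [Module R M] (p : R) (α : Ordinal.{u}) :
    Submodule R M :=
  Ordinal.limitRecOn α ⊤ (fun _ S => Submodule.map (LinearMap.lsmul R M p) S)
    fun β _ ih => ⨅ (γ : Set.Iio β), ih γ.1 γ.2

open scoped Classical in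
/-- The `p`-height of `x`, with `⊤` playing the role of `∞`. -/
def pheight {M : Type u} [AddCommGroup M] [Module R M] (p : R) (x : M) :
    WithTop Ordinal.{u} :=
  if h : ∃ α : Ordinal.{u}, x ∈ ppow p α ∧ x ∉ ppow p (α + 1) then (h.choose : WithTop Ordinal)
  else ⊤

/-- `H⁰ = {x : ∃ a ≠ 0, a • x ∈ H}`. -/
def hull {M : Type u} [AddCommGroup M] [Module R M] (H : Submodule R M) : Set M :=
  {x | ∃ a : R, a ≠ 0 ∧ a • x ∈ H}

/-- `X` is a decomposition set with respect to the single prime `p`. -/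
def IsDecompWrt {M : Type u} [AddCommGroup M] [Module R M] (p : R) (X : Set M) : Prop :=
  (LinearIndependent R (fun x : X => (x : M))) ∧
  (∀ x ∈ X, ∀ a : R, a ≠ 0 → a • x ≠ 0) ∧
  (∀ s : Finset M, ↑s ⊆ X → ∀ c : M → R,
    pheight p (∑ x ∈ s, c x • x) = s.inf fun x => pheight p (c x • x))

/-- `X` is a decomposition set (with respect to every prime of `R`). -/
def IsDecompositionSet (R : Type*) [CommRing R] {M : Type u} [AddCommGroup M] [Module R M]
    (X : Set M) : Prop :=
  ∀ p : R, Prime p → IsDecompWrt p X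

/-- partial decomposition basis, heights taken w.r.t. a fixed prime `p`. -/
def IsPDBWrt {M : Type u} [AddCommGroup M] [Module R M] (p : R) (C : Set (Set M)) : Prop :=
  C.Nonempty ∧ (∀ X ∈ C, X.Finite) ∧ (∀ X ∈ C, IsDecompWrt p X) ∧
  ∀ X ∈ C, ∀ x : M, ∃ Y ∈ C, X ⊆ Y ∧ x ∈ hull (Submodule.span R Y)

/-- partial decomposition basis (heights w.r.t. all primes of `R`). -/
def IsPDB (R : Type*) [CommRing R] {M : Type u} [AddCommGroup M] [Module R M] (C : Set (Set M)) : Prop :=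
  C.Nonempty ∧ (∀ X ∈ C, X.Finite) ∧ (∀ X ∈ C, IsDecompositionSet R X) ∧
  ∀ X ∈ C, ∀ x : M, ∃ Y ∈ C, X ⊆ Y ∧ x ∈ hull (Submodule.span R Y)

/-- A partial isomorphism system `I : G ≅_p H`. -/
def IsPartialIsoSystem {M N : Type*} [AddCommGroup M] [Module R M]
    [AddCommGroup N] [Module R N] (I : Set (M →ₗ.[R] N)) : Prop :=
  I.Nonempty ∧
  (∀ f ∈ I, Function.Injective f.toFun) ∧
  (∀ f ∈ I, ∀ a : M, ∃ g ∈ I, f ≤ g ∧ a ∈ g.domain) ∧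
  (∀ f ∈ I, ∀ b : N, ∃ g ∈ I, f ≤ g ∧ ∃ y : g.domain, g y = b)

/-- The Ulm sequence of `x`: `U(x) = (|pⁱ x|)ᵢ`. -/
def UlmSeqOf {M : Type u} [AddCommGroup M] [Module R M] (p : R) (x : M) :
    ℕ → WithTop Ordinal.{u} :=
  fun i => pheight p ((p ^ i) • x)

/-- `u` is an Ulm sequence. -/
def IsUlmSeq (u : ℕ → WithTop Ordinal.{u}) : Prop :=
  ∀ i, (u i = ⊤ → u (i + 1) = ⊤) ∧ (u i ≠ ⊤ → u i < u (i + 1))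

/-- Equivalence of Ulm sequences. -/
def UlmEquiv (u v : ℕ → WithTop Ordinal.{u}) : Prop :=
  ∃ m n : ℕ, ∀ i, u (i + n) = v (i + m)

/-- `X` contains at least `n` elements whose Ulm sequence is equivalent to `u`. -/
def HasAtLeast {M : Type u} [AddCommGroup M] [Module R M] (p : R)
    (u : ℕ → WithTop Ordinal.{u}) (n : ℕ) (X : Set M) : Prop :=
  ∃ s : Finset M, ↑s ⊆ X ∧ n ≤ s.card ∧ ∀ x ∈ s, UlmEquiv (UlmSeqOf p x) u

/-- `ŵ_C(e,G)` where `e` is the class of the Ulm sequence `u`. -/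
def wHat {M : Type u} [AddCommGroup M] [Module R M] (p : R) (C : Set (Set M))
    (u : ℕ → WithTop Ordinal.{u}) : ℕ∞ :=
  sSup {N : ℕ∞ | ∃ n : ℕ, N = (n : ℕ∞) ∧ ∃ X ∈ C, HasAtLeast p u n X}

/-- `x` is proper with respect to `S`. -/
def IsProper {M : Type u} [AddCommGroup M] [Module R M] (p : R) (S : Submodule R M)
    (x : M) : Prop :=
  ∀ s ∈ S, pheight p (x + s) ≤ pheight p x

/-- `H` is a nice submodule. -/
def IsNice {M : Type u} [AddCommGroup M] [Module R M] (p : R) (H : Submodule R M) : Prop :=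
  ∀ x : M, ∃ h ∈ H, ∀ h' ∈ H, pheight p (x + h') ≤ pheight p (x + h)

/-- The Ulm invariant `u_p(σ, M)`: the dimension of `(p^σ M)[p]/(p^{σ+1} M)[p]`
over the residue field `R/(p)`. -/
def uCard (p : R) (M : Type u) [AddCommGroup M] [Module R M] (σ : Ordinal.{u}) :
    Cardinal :=
  let V : Submodule R M := ppow p σ ⊓ Submodule.torsionBy R M p
  let W : Submodule R V := (ppow p (σ + 1) ⊓ Submodule.torsionBy R M p).comap V.subtype
  Module.rank (R ⧸ Ideal.span {p})
    ((V ⧸ W) ⧸ (Ideal.span {p} • (⊤ : Submodule R (V ⧸ W))))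

/-- `û_p(σ, M) = min (u_p(σ, M), ω)`. -/
def uHat (p : R) (M : Type u) [AddCommGroup M] [Module R M] (σ : Ordinal.{u}) : Cardinal :=
  min (uCard p M σ) Cardinal.aleph0

/-- `û_p(∞, M) = min (dim (p^∞ M)[p], ω)`. -/
def uHatInf (p : R) (M : Type u) [AddCommGroup M] [Module R M] : Cardinal :=
  let V : Submodule R M := (⨅ α : Ordinal.{u}, ppow p α) ⊓ Submodule.torsionBy R M p
  min (Module.rank (R ⧸ Ideal.span {p})
    (V ⧸ (Ideal.span {p} • (⊤ : Submodule R V)))) Cardinal.aleph0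

end UlmW

open UlmW

/-- The ideal `(p) ⊆ ℤ` is prime. -/
instance zpSpanPrime (p : ℤ) [hp : Fact (Prime p)] : (Ideal.span {p} : Ideal ℤ).IsPrime :=
  (Ideal.span_singleton_prime hp.out.ne_zero).mpr hp.out

/-- `ℤ_(p)`, the integers localized at the prime `p`. -/
abbrev Zp (p : ℤ) [Fact (Prime p)] : Type :=
  Localization.AtPrime (Ideal.span {p} : Ideal ℤ)


universe u

open UlmW


namespace UlmW

section General

variable {R : Type*} [CommRing R] {M N : Type u} [AddCommGroup M] [Module R M]
  [AddCommGroup N] [Module R N]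

lemma ppow_zero (p : R) : (ppow p 0 : Submodule R M) = ⊤ :=
  Ordinal.limitRecOn_zero ..

lemma ppow_add_one (p : R) (α : Ordinal.{u}) :
    (ppow p (α + 1) : Submodule R M) = (ppow p α).map (LinearMap.lsmul R M p) :=
  Ordinal.limitRecOn_add_one ..

lemma ppow_limit (p : R) {β : Ordinal.{u}} (hβ : Order.IsSuccLimit β) :
    (ppow p β : Submodule R M) = ⨅ γ : Set.Iio β, ppow p γ.1 :=
  Ordinal.limitRecOn_limit _ _ _ _ hβ

lemma mem_ppow_add_one {p : R} {α : Ordinal.{u}} {x : M} :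
    x ∈ ppow p (α + 1) ↔ ∃ y ∈ ppow p α, p • y = x := by
  rw [ppow_add_one]
  rfl

lemma mem_ppow_limit {p : R} {β : Ordinal.{u}} (hβ : Order.IsSuccLimit β) {x : M} :
    x ∈ ppow p β ↔ ∀ γ < β, x ∈ ppow p γ := by
  simp [ppow_limit p hβ]

lemma smul_mem_ppow_add_one {p : R} {α : Ordinal.{u}} {x : M} (hx : x ∈ ppow p α) :
    p • x ∈ ppow p (α + 1) :=
  mem_ppow_add_one.2 ⟨x, hx, rfl⟩

lemma ppow_antitone (p : R) : Antitone fun α : Ordinal.{u} => (ppow p α : Submodule R M) := by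
  intro α β hαβ
  induction β using Ordinal.limitRecOn with
  | zero => rw [nonpos_iff_eq_zero.1 hαβ]
  | add_one β ih =>
    rcases hαβ.eq_or_lt with rfl | h
    · exact le_rfl
    · intro x hx
      obtain ⟨y, hy, rfl⟩ := mem_ppow_add_one.1 hx
      exact Submodule.smul_mem _ _ (ih (Order.lt_add_one_iff.1 h) hy)
  | limit β hβ ih =>
    rcases hαβ.eq_or_lt with rfl | h
    · exact le_rfl
    · exact fun x hx => (mem_ppow_limit hβ).1 hx α h

lemma ppow_add_one_le (p : R) (α : Ordinal.{u}) :
    (ppow p (α + 1) : Submodule R M) ≤ ppow p α :=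
  ppow_antitone p (Order.le_succ α)

lemma mem_ppow_iff_le_pheight {p : R} {α : Ordinal.{u}} {x : M} :
    x ∈ ppow p α ↔ (α : WithTop Ordinal.{u}) ≤ pheight p x := by
  unfold pheight
  split_ifs with h
  · rw [WithTop.coe_le_coe]
    refine ⟨fun hx => ?_, fun hα => ppow_antitone p hα h.choose_spec.1⟩
    by_contra! hlt
    exact h.choose_spec.2 (ppow_antitone p (Order.add_one_le_of_lt hlt) hx)
  · push Not at h
    simp only [le_top, iff_true]
    induction α using Ordinal.limitRecOn with
    | zero => simp [ppow_zero]
    | add_one α ih => exact h α ih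
    | limit α hα ih => exact (mem_ppow_limit hα).2 ih

lemma exists_pheight_eq_coe {p : R} (hM : (⨅ α : Ordinal.{u}, (ppow p α : Submodule R M)) = ⊥)
    {x : M} (hx : x ≠ 0) : ∃ α : Ordinal.{u}, pheight p x = α := by
  by_contra! h
  have htop : pheight p x = ⊤ := by
    by_contra hne
    exact h _ (WithTop.coe_untop _ hne).symm
  refine hx ((Submodule.mem_bot R).1 (hM ▸ (Submodule.mem_iInf _).2 fun α => ?_))
  rw [mem_ppow_iff_le_pheight, htop]
  exact le_top

lemma map_ppow (p : R) (e : M ≃ₗ[R] N) (α : Ordinal.{u}) :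
    (ppow p α).map (e : M →ₗ[R] N) = ppow p α := by
  induction α using Ordinal.limitRecOn with
  | zero => simp [ppow_zero]
  | add_one α ih =>
    rw [ppow_add_one, ppow_add_one, ← ih, ← Submodule.map_comp, ← Submodule.map_comp]
    congr 1
    ext x
    simp
  | limit α hα ih =>
    ext y
    rw [Submodule.mem_map_equiv, mem_ppow_limit hα, mem_ppow_limit hα]
    refine forall₂_congr fun γ hγ => ?_
    rw [← ih γ hγ, Submodule.mem_map_equiv]

/-- The subgroup `(p^α M)[p]`. -/
abbrev ulmSocle (p : R) (M : Type u) [AddCommGroup M] [Module R M] (α : Ordinal.{u}) :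
    Submodule R M :=
  ppow p α ⊓ Submodule.torsionBy R M p

/-- The quotient `(p^α M)[p] / (p^(α+1) M)[p]`. -/
abbrev UlmQuotient (p : R) (M : Type u) [AddCommGroup M] [Module R M] (α : Ordinal.{u}) : Type u :=
  ulmSocle p M α ⧸ (ulmSocle p M (α + 1)).comap (ulmSocle p M α).subtype

lemma map_ulmSocle (p : R) (e : M ≃ₗ[R] N) (α : Ordinal.{u}) :
    (ulmSocle p M α).map (e : M →ₗ[R] N) = ulmSocle p N α := by
  ext y
  rw [Submodule.mem_map_equiv, Submodule.mem_inf, Submodule.mem_inf, ← map_ppow p e,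
    Submodule.mem_map_equiv, Submodule.mem_torsionBy_iff, Submodule.mem_torsionBy_iff,
    ← map_smul, LinearEquiv.map_eq_zero_iff]

/-- The equivalence of Ulm quotients induced by an equivalence of modules. -/
def ulmQuotientEquiv (p : R) (e : M ≃ₗ[R] N) (α : Ordinal.{u}) :
    UlmQuotient p M α ≃ₗ[R] UlmQuotient p N α :=
  Submodule.Quotient.equiv _ _ (e.ofSubmodules _ _ (map_ulmSocle p e α)) <| by
    ext ⟨y, hy⟩
    rw [Submodule.mem_map_equiv, Submodule.mem_comap, Submodule.mem_comap,
      ← map_ulmSocle p e (α + 1)]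
    exact (Submodule.mem_map_equiv _).symm

lemma uCard_eq_of_linearEquiv (p : R) (e : M ≃ₗ[R] N) (α : Ordinal.{u}) :
    uCard p M α = uCard p N α := by
  let e' : (UlmQuotient p M α ⧸ Ideal.span {p} • (⊤ : Submodule R (UlmQuotient p M α))) ≃ₗ[R]
      (UlmQuotient p N α ⧸ Ideal.span {p} • (⊤ : Submodule R (UlmQuotient p N α))) :=
    Submodule.Quotient.equiv _ _ (ulmQuotientEquiv p e α) <| by
      rw [Submodule.map_smul'', Submodule.map_top, LinearEquiv.range]
  refine rank_eq_of_equiv_equiv (R := R ⧸ Ideal.span {p}) id e'.toAddEquiv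
    Function.bijective_id fun r m => ?_
  obtain ⟨r, rfl⟩ := Ideal.Quotient.mk_surjective r
  exact e'.map_smul r m

lemma span_smul_ulmQuotient (p : R) (α : Ordinal.{u}) :
    Ideal.span {p} • (⊤ : Submodule R (UlmQuotient p M α)) = ⊥ := by
  rw [Submodule.ideal_span_singleton_smul, eq_bot_iff]
  rintro _ ⟨y, -, rfl⟩
  obtain ⟨v, rfl⟩ := Submodule.Quotient.mk_surjective _ y
  have hv : p • v = 0 := Subtype.ext ((Submodule.mem_torsionBy_iff _ _).1 v.2.2)
  change p • (Submodule.Quotient.mk v : UlmQuotient p M α) = 0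
  rw [← Submodule.Quotient.mk_smul, hv, Submodule.Quotient.mk_zero]

lemma nonempty_ulmQuotient_equiv {p : R} [hp : (Ideal.span {p}).IsMaximal] {α : Ordinal.{u}}
    (h : uCard p M α = uCard p N α) :
    Nonempty (UlmQuotient p M α ≃ UlmQuotient p N α) := by
  let : Field (R ⧸ Ideal.span {p}) := Ideal.Quotient.field _
  obtain ⟨e⟩ := nonempty_linearEquiv_of_rank_eq (R := R ⧸ Ideal.span {p}) h
  exact ⟨((Submodule.quotEquivOfEqBot _ (span_smul_ulmQuotient p α)).toEquiv.symm.trans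
    e.toEquiv).trans (Submodule.quotEquivOfEqBot _ (span_smul_ulmQuotient p α)).toEquiv⟩

/-- A relation between `M` and `N`, given as a submodule of `M × N`, preserves heights if related
elements lie in the same submodules `p^α`. -/
def PreservesHeight (p : R) (Γ : Submodule R (M × N)) : Prop :=
  ∀ z ∈ Γ, ∀ α : Ordinal.{u}, z.1 ∈ ppow p α ↔ z.2 ∈ ppow p α

lemma PreservesHeight.fst_eq_zero_iff {p : R} {Γ : Submodule R (M × N)} (hΓ : PreservesHeight p Γ)
    (hM : (⨅ α : Ordinal.{u}, (ppow p α : Submodule R M)) = ⊥)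
    (hN : (⨅ α : Ordinal.{u}, (ppow p α : Submodule R N)) = ⊥)
    {z : M × N} (hz : z ∈ Γ) : z.1 = 0 ↔ z.2 = 0 := by
  rw [← Submodule.mem_bot R, ← Submodule.mem_bot R, ← hM, ← hN, Submodule.mem_iInf,
    Submodule.mem_iInf]
  exact forall_congr' (hΓ z hz)

lemma PreservesHeight.swap {p : R} {Γ : Submodule R (M × N)} (hΓ : PreservesHeight p Γ) :
    PreservesHeight p (Γ.map (LinearEquiv.prodComm R M N : M × N →ₗ[R] N × M)) := by
  rintro _ ⟨z, hz, rfl⟩ α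
  exact (hΓ z hz α).symm

/-- If a finite height-preserving relation does not exhaust the `α`-th Ulm quotient of `M`, then it
does not exhaust that of `N` either, provided the two quotients are equinumerous. -/
lemma PreservesHeight.exists_proper_socle {p : R} {Γ : Submodule R (M × N)}
    (hΓ : PreservesHeight p Γ) [Finite Γ] {α : Ordinal.{u}}
    (e : UlmQuotient p M α ≃ UlmQuotient p N α) {x : M} (hx : x ∈ ulmSocle p M α)
    (hxΓ : ∀ z ∈ Γ, x + z.1 ∉ ppow p (α + 1)) :
    ∃ w ∈ ulmSocle p N α, ∀ z ∈ Γ, w + z.2 ∉ ppow p (α + 1) := by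
  by_contra! hcon
  have key : ∀ c : UlmQuotient p N α, ∃ (s : ulmSocle p N α) (z : M × N) (t : ulmSocle p M α),
      Submodule.Quotient.mk s = c ∧ z ∈ Γ ∧ (s : N) + z.2 ∈ ppow p (α + 1) ∧
        (t : M) + z.1 ∈ ppow p (α + 1) := by
    intro c
    obtain ⟨s, rfl⟩ := Submodule.Quotient.mk_surjective _ c
    obtain ⟨z, hz, hsz⟩ := hcon s s.2
    have hz2 : z.2 ∈ ppow p α := (Submodule.add_mem_iff_right _ s.2.1).1 (ppow_add_one_le p α hsz)
    have hpz2 : p • z.2 ∈ ppow p (α + 1 + 1) := by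
      have := smul_mem_ppow_add_one hsz
      rwa [smul_add, (Submodule.mem_torsionBy_iff _ _).1 s.2.2, zero_add] at this
    have hz1 : z.1 ∈ ppow p α := (hΓ z hz α).2 hz2
    obtain ⟨y, hy, hyz⟩ := mem_ppow_add_one.1 ((hΓ _ (Γ.smul_mem p hz) _).2 hpz2)
    refine ⟨s, z, ⟨y - z.1, Submodule.sub_mem _ (ppow_add_one_le p α hy) hz1, ?_⟩, rfl, hz, hsz, by simpa⟩
    rw [SetLike.mem_coe, Submodule.mem_torsionBy_iff, smul_sub, hyz]
    exact sub_self _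
  choose s z t hs hz hsz htz using key
  have eq_of_mem : ∀ c d, (z c - z d).2 ∈ ppow p (α + 1) → c = d := by
    intro c d h
    rw [← hs c, ← hs d, Submodule.Quotient.eq]
    refine ⟨?_, (s c - s d).2.2⟩
    rw [SetLike.mem_coe]
    have := Submodule.sub_mem _ (Submodule.sub_mem _ (hsz c) (hsz d)) h
    convert this using 1
    simp only [Submodule.subtype_apply, Submodule.coe_sub, Prod.snd_sub]
    abel
  have : Finite (UlmQuotient p N α) := by
    refine Finite.of_injective (fun c => (⟨z c, hz c⟩ : Γ)) fun c d h => eq_of_mem c d ?_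
    rw [Subtype.mk.injEq] at h
    simp [h]
  have hinj : Function.Injective fun c => (Submodule.Quotient.mk (t c) : UlmQuotient p M α) := by
    intro c d h
    refine eq_of_mem c d ((hΓ _ (Γ.sub_mem (hz c) (hz d)) _).1 ?_)
    have := Submodule.sub_mem _ (Submodule.sub_mem _ (htz c) (htz d))
      ((Submodule.Quotient.eq _).1 h).1
    convert this using 1
    simp only [Submodule.subtype_apply, Submodule.coe_sub, Prod.fst_sub]
    abel
  have hsurj : Function.Surjective fun c => (Submodule.Quotient.mk (t c) : UlmQuotient p M α) := by
    have : Finite (UlmQuotient p M α) := Finite.of_equiv _ e.symm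
    exact (Finite.surjective_of_injective (hinj.comp e.injective)).of_comp
  obtain ⟨c, hc⟩ := hsurj (Submodule.Quotient.mk ⟨x, hx⟩)
  refine hxΓ (z c) (hz c) ?_
  have := Submodule.sub_mem _ (htz c) ((Submodule.Quotient.eq _).1 hc).1
  convert this using 1
  simp only [Submodule.subtype_apply, Submodule.coe_sub]
  abel

end General

section PrimaryGroups

variable {G H : Type u} [AddCommGroup G] [AddCommGroup H] {p : ℤ}

/-- The height of `a + n • x`, for `a` in a subgroup with respect to which `x` is proper. -/
lemma add_zsmul_mem_ppow_iff (hp : Prime p) {A : Submodule ℤ G} {α β : Ordinal.{u}} {x a : G}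
    {n : ℤ} (hn : ¬ p ∣ n) (hpx : p • x ∈ A) (hx : x ∈ ppow p α)
    (hxA : ∀ b ∈ A, x + b ∉ ppow p (α + 1)) (ha : a ∈ A) :
    a + n • x ∈ ppow p β ↔ β ≤ α ∧ a ∈ ppow p β := by
  constructor
  · intro h
    have hβ : β ≤ α := by
      by_contra! hlt
      obtain ⟨s, t, hst⟩ := (hp.coprime_iff_not_dvd.2 hn : IsCoprime p n)
      refine hxA (t • a - s • p • x) (A.sub_mem (A.smul_mem _ ha) (A.smul_mem _ hpx)) ?_
      have h' := Submodule.smul_mem _ t (ppow_antitone p (Order.add_one_le_of_lt hlt) h)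
      convert h' using 1
      have : x = (s * p + t * n) • x := by rw [hst, one_smul]
      nth_rewrite 1 [this]
      module
    exact ⟨hβ, (Submodule.add_mem_iff_left _
      (Submodule.smul_mem _ n (ppow_antitone p hβ hx))).1 h⟩
  · rintro ⟨hβ, ha'⟩
    exact Submodule.add_mem _ ha' (Submodule.smul_mem _ n (ppow_antitone p hβ hx))

/-- A height-preserving relation extends by a pair of proper elements of equal height whose
`p`-multiples are already related. -/
lemma PreservesHeight.sup_span_singleton (hp : Prime p) {Γ : Submodule ℤ (G × H)}
    (hΓ : PreservesHeight p Γ) {α : Ordinal.{u}} {x : G} {w : H} (hxw : (p • x, p • w) ∈ Γ)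
    (hx : x ∈ ppow p α) (hw : w ∈ ppow p α)
    (hxΓ : ∀ z ∈ Γ, x + z.1 ∉ ppow p (α + 1)) (hwΓ : ∀ z ∈ Γ, w + z.2 ∉ ppow p (α + 1)) :
    PreservesHeight p (Γ ⊔ Submodule.span ℤ {(x, w)}) := by
  intro y hy β
  obtain ⟨z, hz, _, hv, rfl⟩ := Submodule.mem_sup.1 hy
  obtain ⟨n, rfl⟩ := Submodule.mem_span_singleton.1 hv
  by_cases hn : p ∣ n
  · obtain ⟨m, rfl⟩ := hn
    refine hΓ _ (Γ.add_mem hz ?_) β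
    rw [mul_comm, mul_smul]
    exact Γ.smul_mem m hxw
  · have h₁ := add_zsmul_mem_ppow_iff (A := Γ.map (LinearMap.fst ℤ G H)) (a := z.1) (β := β)
      hp hn ⟨_, hxw, rfl⟩ hx (by rintro _ ⟨b, hb, rfl⟩; exact hxΓ b hb) ⟨z, hz, rfl⟩
    have h₂ := add_zsmul_mem_ppow_iff (A := Γ.map (LinearMap.snd ℤ G H)) (a := z.2) (β := β)
      hp hn ⟨_, hxw, rfl⟩ hw (by rintro _ ⟨b, hb, rfl⟩; exact hwΓ b hb) ⟨z, hz, rfl⟩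
    exact h₁.trans ((and_congr_right fun _ => hΓ z hz β).trans h₂.symm)

/-- Kaplansky–Mackey: one step of the extension of a finite height-preserving relation. -/
lemma PreservesHeight.exists_extension_of_smul_mem (hp : Prime p)
    (hGred : (⨅ α : Ordinal.{u}, (ppow p α : Submodule ℤ G)) = ⊥)
    (hu : ∀ α : Ordinal.{u}, Nonempty (UlmQuotient p G α ≃ UlmQuotient p H α))
    {Γ : Submodule ℤ (G × H)} (hΓ : PreservesHeight p Γ) (hfg : Γ.FG) [Finite Γ]
    {x : G} {v : H} (hxv : (p • x, v) ∈ Γ) :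
    ∃ Γ' : Submodule ℤ (G × H), Γ ≤ Γ' ∧ Γ'.FG ∧ PreservesHeight p Γ' ∧ ∃ w, (x, w) ∈ Γ' := by
  by_cases hxΓ : ∃ w, (x, w) ∈ Γ
  · exact ⟨Γ, le_rfl, hfg, hΓ, hxΓ⟩
  obtain ⟨c, hc⟩ := Finite.exists_max fun z : Γ =>
    toLex (pheight p (x + z.1.1), pheight p (p • (x + z.1.1)))
  set x' := x + c.1.1 with hx'
  have hx'v : (p • x', v + p • c.1.2) ∈ Γ := by
    convert Γ.add_mem hxv (Γ.smul_mem p c.2) using 1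
    simp [Prod.ext_iff, hx', smul_add]
  have hmax : ∀ z ∈ Γ, pheight p (x' + z.1) < pheight p x' ∨
      pheight p (x' + z.1) = pheight p x' ∧ pheight p (p • (x' + z.1)) ≤ pheight p (p • x') := by
    intro z hz
    have := Prod.Lex.toLex_le_toLex.1 (hc ⟨c.1 + z, Γ.add_mem c.2 hz⟩)
    simpa [hx', add_assoc] using this
  have hx'0 : x' ≠ 0 := fun h0 => hxΓ ⟨-c.1.2, by
    convert Γ.neg_mem c.2 using 1
    exact Prod.ext (eq_neg_of_add_eq_zero_left h0) rfl⟩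
  obtain ⟨α, hα⟩ := exists_pheight_eq_coe hGred hx'0
  have hx'α : x' ∈ ppow p α := mem_ppow_iff_le_pheight.2 hα.ge
  have hproper : ∀ z ∈ Γ, x' + z.1 ∉ ppow p (α + 1) := by
    intro z hz h
    rw [mem_ppow_iff_le_pheight] at h
    have hle : pheight p (x' + z.1) ≤ α := by
      rw [← hα]
      rcases hmax z hz with h | h
      exacts [h.le, h.1.le]
    exact (Order.lt_add_one_iff.2 le_rfl).not_ge (WithTop.coe_le_coe.1 (h.trans hle))
  suffices ∃ w ∈ ppow p α, p • w = v + p • c.1.2 ∧ ∀ z ∈ Γ, w + z.2 ∉ ppow p (α + 1) by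
    obtain ⟨w, hw, hpw, hwΓ⟩ := this
    refine ⟨Γ ⊔ Submodule.span ℤ {(x', w)}, le_sup_left,
      hfg.sup (Submodule.fg_span_singleton _),
      hΓ.sup_span_singleton hp (hpw ▸ hx'v) hx'α hw hproper hwΓ, w - c.1.2, ?_⟩
    have := Submodule.sub_mem _ (Submodule.mem_sup_right (S := Γ)
      (Submodule.mem_span_singleton_self (x', w))) (Submodule.mem_sup_left c.2)
    convert this using 1
    simp [Prod.ext_iff, hx']
  by_cases hdeep : p • x' ∈ ppow p (α + 1 + 1)
  · obtain ⟨y, hy, hyx⟩ := mem_ppow_add_one.1 hdeep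
    obtain ⟨w₂, hw₂, hpw₂⟩ := mem_ppow_add_one.1 ((hΓ _ hx'v _).1 hdeep)
    obtain ⟨w₁, hw₁, hw₁Γ⟩ := hΓ.exists_proper_socle (hu α).some (x := x' - y)
      ⟨Submodule.sub_mem _ hx'α (ppow_add_one_le p α hy), by
        rw [SetLike.mem_coe, Submodule.mem_torsionBy_iff, smul_sub, hyx, sub_self]⟩
      fun z hz h => hproper z hz (by
        convert Submodule.add_mem _ h hy using 1
        abel)
    refine ⟨w₁ + w₂, Submodule.add_mem _ hw₁.1 (ppow_add_one_le p α hw₂), ?_, fun z hz h => hw₁Γ z hz ?_⟩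
    · rw [smul_add, (Submodule.mem_torsionBy_iff _ _).1 hw₁.2, zero_add, hpw₂]
    · convert Submodule.sub_mem _ h hw₂ using 1
      abel
  · obtain ⟨w, hw, hpw⟩ := mem_ppow_add_one.1 ((hΓ _ hx'v _).1 (smul_mem_ppow_add_one hx'α))
    refine ⟨w, hw, hpw, fun z hz h => hdeep ?_⟩
    have hz₂ : z.2 ∈ ppow p α :=
      (Submodule.add_mem_iff_right _ hw).1 (ppow_add_one_le p α h)
    have hz₁ : x' + z.1 ∈ ppow p α := Submodule.add_mem _ hx'α ((hΓ z hz α).2 hz₂)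
    have hpz : p • (x' + z.1) ∈ ppow p (α + 1 + 1) := by
      have hmem : (p • (x' + z.1), p • (w + z.2)) ∈ Γ := by
        convert Γ.add_mem hx'v (Γ.smul_mem p hz) using 1
        simp [Prod.ext_iff, smul_add, hpw]
      exact (hΓ _ hmem _).2 (smul_mem_ppow_add_one h)
    rw [mem_ppow_iff_le_pheight] at hpz hz₁ ⊢
    rcases hmax z hz with hlt | ⟨-, hle⟩
    · exact absurd (hα ▸ hz₁) hlt.not_ge
    · exact hpz.trans hle

lemma finite_of_fg_of_primary (hp : Prime p) (hGp : ∀ g : G, ∃ k : ℕ, p ^ k • g = 0)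
    (hHp : ∀ h : H, ∃ k : ℕ, p ^ k • h = 0) {Γ : Submodule ℤ (G × H)} (hfg : Γ.FG) :
    Finite Γ := by
  have : Module.Finite ℤ Γ := Module.Finite.iff_fg.2 hfg
  refine Module.finite_of_fg_torsion _ fun {z} => ?_
  obtain ⟨k, hk⟩ := hGp z.1.1
  obtain ⟨l, hl⟩ := hHp z.1.2
  refine ⟨⟨p ^ k * p ^ l, mem_nonZeroDivisors_of_ne_zero
    (mul_ne_zero (pow_ne_zero _ hp.ne_zero) (pow_ne_zero _ hp.ne_zero))⟩, Subtype.ext ?_⟩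
  refine Prod.ext ?_ ?_
  · change (p ^ k * p ^ l) • z.1.1 = 0
    rw [mul_comm, mul_smul, hk, smul_zero]
  · change (p ^ k * p ^ l) • z.1.2 = 0
    rw [mul_smul, hl, smul_zero]

lemma PreservesHeight.exists_extension (hp : Prime p) (hGp : ∀ g : G, ∃ k : ℕ, p ^ k • g = 0)
    (hHp : ∀ h : H, ∃ k : ℕ, p ^ k • h = 0)
    (hGred : (⨅ α : Ordinal.{u}, (ppow p α : Submodule ℤ G)) = ⊥)
    (hu : ∀ α : Ordinal.{u}, Nonempty (UlmQuotient p G α ≃ UlmQuotient p H α))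
    {Γ : Submodule ℤ (G × H)} (hΓ : PreservesHeight p Γ) (hfg : Γ.FG) (x : G) :
    ∃ Γ' : Submodule ℤ (G × H), Γ ≤ Γ' ∧ Γ'.FG ∧ PreservesHeight p Γ' ∧ ∃ w, (x, w) ∈ Γ' := by
  obtain ⟨k, hk⟩ := hGp x
  induction k generalizing x with
  | zero =>
    rw [pow_zero, one_smul] at hk
    exact ⟨Γ, le_rfl, hfg, hΓ, 0, hk ▸ Γ.zero_mem⟩
  | succ k ih =>
    obtain ⟨Γ₁, hle₁, hfg₁, hΓ₁, v, hv⟩ := ih (p • x) (by rwa [← mul_smul, ← pow_succ])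
    have := finite_of_fg_of_primary hp hGp hHp hfg₁
    obtain ⟨Γ₂, hle₂, hΓ₂⟩ := hΓ₁.exists_extension_of_smul_mem hp hGred hu hfg₁ hv
    exact ⟨Γ₂, hle₁.trans hle₂, hΓ₂⟩

lemma PreservesHeight.exists_extension_right (hp : Prime p)
    (hGp : ∀ g : G, ∃ k : ℕ, p ^ k • g = 0) (hHp : ∀ h : H, ∃ k : ℕ, p ^ k • h = 0)
    (hHred : (⨅ α : Ordinal.{u}, (ppow p α : Submodule ℤ H)) = ⊥)
    (hu : ∀ α : Ordinal.{u}, Nonempty (UlmQuotient p G α ≃ UlmQuotient p H α))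
    {Γ : Submodule ℤ (G × H)} (hΓ : PreservesHeight p Γ) (hfg : Γ.FG) (w : H) :
    ∃ Γ' : Submodule ℤ (G × H), Γ ≤ Γ' ∧ Γ'.FG ∧ PreservesHeight p Γ' ∧ ∃ x, (x, w) ∈ Γ' := by
  obtain ⟨Γ', hle, hfg', hΓ', x, hx⟩ := hΓ.swap.exists_extension hp hHp hGp hHred
    (fun α => ⟨(hu α).some.symm⟩) (hfg.map _) w
  exact ⟨Γ'.map (LinearEquiv.prodComm ℤ H G : H × G →ₗ[ℤ] G × H),
    fun z hz => ⟨z.swap, hle ⟨z, hz, rfl⟩, rfl⟩, hfg'.map _, hΓ'.swap, x, (w, x), hx, rfl⟩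

/-- An additive relation that is total on both sides and respects zero in both directions
is an isomorphism. -/
lemma nonempty_addEquiv_of_relation (Γ : AddSubgroup (G × H))
    (hzero : ∀ z ∈ Γ, z.1 = 0 ↔ z.2 = 0) (hG : ∀ x : G, ∃ w, (x, w) ∈ Γ)
    (hH : ∀ w : H, ∃ x, (x, w) ∈ Γ) : Nonempty (G ≃+ H) := by
  choose f hf using hG
  have heq : ∀ z ∈ Γ, ∀ z' ∈ Γ, z.1 = z'.1 ↔ z.2 = z'.2 := by
    intro z hz z' hz'
    simpa [sub_eq_zero] using hzero _ (Γ.sub_mem hz hz')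
  refine ⟨AddEquiv.ofBijective (AddMonoidHom.mk' f fun a b => ?_) ⟨fun a b h => ?_, fun w => ?_⟩⟩
  · exact (heq _ (hf (a + b)) _ (Γ.add_mem (hf a) (hf b))).1 rfl
  · exact (heq _ (hf a) _ (hf b)).2 h
  · obtain ⟨x, hx⟩ := hH w
    exact ⟨x, (heq _ (hf x) _ hx).1 rfl⟩

lemma nonempty_addEquiv_of_ulmQuotient_equiv [Countable G] [Countable H] (hp : Prime p)
    (hGp : ∀ g : G, ∃ k : ℕ, p ^ k • g = 0) (hHp : ∀ h : H, ∃ k : ℕ, p ^ k • h = 0)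
    (hGred : (⨅ α : Ordinal.{u}, (ppow p α : Submodule ℤ G)) = ⊥)
    (hHred : (⨅ α : Ordinal.{u}, (ppow p α : Submodule ℤ H)) = ⊥)
    (hu : ∀ α : Ordinal.{u}, Nonempty (UlmQuotient p G α ≃ UlmQuotient p H α)) :
    Nonempty (G ≃+ H) := by
  let P := {Γ : Submodule ℤ (G × H) // Γ.FG ∧ PreservesHeight p Γ}
  let Γ₀ : P := ⟨⊥, Submodule.fg_bot, by
    rintro z hz α
    simp [(Submodule.mem_bot ℤ).1 hz]⟩
  let 𝒟 : G ⊕ H → Order.Cofinal P := Sum.elim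
    (fun x => ⟨{Γ | ∃ w, (x, w) ∈ Γ.1}, fun Γ => by
      obtain ⟨Γ', hle, hfg, hΓ', hx⟩ :=
        Γ.2.2.exists_extension hp hGp hHp hGred hu Γ.2.1 x
      exact ⟨⟨Γ', hfg, hΓ'⟩, hx, hle⟩⟩)
    (fun w => ⟨{Γ | ∃ x, (x, w) ∈ Γ.1}, fun Γ => by
      obtain ⟨Γ', hle, hfg, hΓ', hw⟩ :=
        Γ.2.2.exists_extension_right hp hGp hHp hHred hu Γ.2.1 w
      exact ⟨⟨Γ', hfg, hΓ'⟩, hw, hle⟩⟩)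
  let := Encodable.ofCountable (G ⊕ H)
  let I := Order.idealOfCofinals Γ₀ 𝒟
  let U : AddSubgroup (G × H) :=
    { carrier := {z | ∃ Γ ∈ I, z ∈ Γ.1}
      zero_mem' := ⟨Γ₀, Order.mem_idealOfCofinals _ _, zero_mem _⟩
      add_mem' := by
        rintro y z ⟨Γ, hΓ, hy⟩ ⟨Γ', hΓ', hz⟩
        obtain ⟨Δ, hΔ, hle, hle'⟩ := I.directed _ hΓ _ hΓ'
        exact ⟨Δ, hΔ, Δ.1.add_mem (hle hy) (hle' hz)⟩
      neg_mem' := by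
        rintro z ⟨Γ, hΓ, hz⟩
        exact ⟨Γ, hΓ, Γ.1.neg_mem hz⟩ }
  refine nonempty_addEquiv_of_relation U ?_ (fun x => ?_) fun w => ?_
  · rintro z ⟨Γ, -, hz⟩
    exact Γ.2.2.fst_eq_zero_iff hGred hHred hz
  · obtain ⟨Γ, ⟨w, hw⟩, hΓ⟩ := Order.cofinal_meets_idealOfCofinals Γ₀ 𝒟 (Sum.inl x)
    exact ⟨w, Γ, hΓ, hw⟩
  · obtain ⟨Γ, ⟨x, hx⟩, hΓ⟩ := Order.cofinal_meets_idealOfCofinals Γ₀ 𝒟 (Sum.inr w)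
    exact ⟨x, Γ, hΓ, hx⟩

end PrimaryGroups

end UlmW

theorem statement_16 (q : ℕ) (hq : q.Prime) {G H : Type u} [AddCommGroup G]
    [AddCommGroup H] [Countable G] [Countable H]
    (hGp : ∀ g : G, ∃ k : ℕ, (q : ℤ) ^ k • g = 0)
    (hHp : ∀ h : H, ∃ k : ℕ, (q : ℤ) ^ k • h = 0)
    (hGred : (⨅ α : Ordinal.{u}, (ppow ((q : ℤ)) α : Submodule ℤ G)) = ⊥)
    (hHred : (⨅ α : Ordinal.{u}, (ppow ((q : ℤ)) α : Submodule ℤ H)) = ⊥) :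
    Nonempty (G ≃+ H) ↔ ∀ α : Ordinal.{u}, uCard (q : ℤ) G α = uCard (q : ℤ) H α := by
  have hp : Prime (q : ℤ) := Nat.prime_iff_prime_int.1 hq
  constructor
  · rintro ⟨e⟩ α
    exact uCard_eq_of_linearEquiv _ e.toIntLinearEquiv α
  · intro h
    have : (Ideal.span {(q : ℤ)}).IsMaximal :=
      PrincipalIdealRing.isMaximal_of_irreducible hp.irreducible
    exact nonempty_addEquiv_of_ulmQuotient_equiv hp hGp hHp hGred hHred
      fun α => nonempty_ulmQuotient_equiv (h α)

end
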